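/- Let k ≥ 1 be a natural number and ħ ∈ ℂ with Re(ħ) < 0, and let Z_k(x, ħ) = Σ_{m=0}^∞ (m!)^k · exp(½·m·(m−1)·ħ) · (ħ^k · x)^m. Then the quantum curve equation holds: for every x ∈ ℂ, ħ · x · d/dx [ Z_k(x, ħ) − ħ^k · x · (L^k (Z_k(·, ħ)))(e^ħ · x) ] = 0, i.e. Z_k(·, ħ) is annihilated by the operator P = ħ x (d/dx) ∘ (1 − ħ^k x e^{ħ x d/dx} ((d/dx)·x)^k). -/

import Mathlib

/-- The operator `L` sending an entire function `f` to `x ↦ d/dx (x · f(x))`,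
written `(d/dx)·x` in the paper. -/
noncomputable def Lop (f : ℂ → ℂ) : ℂ → ℂ := fun x => deriv (fun t => t * f t) x

open Filter Topology

/-- The coefficients of a power series with infinite radius of convergence. -/
def EntireCoeff (a : ℕ → ℂ) : Prop := ∀ r : ℝ, 0 ≤ r → Summable fun m => ‖a m‖ * r ^ m

lemma EntireCoeff.summable {a : ℕ → ℂ} (ha : EntireCoeff a) (z : ℂ) :
    Summable fun m => a m * z ^ m :=
  .of_norm <| by simpa using ha ‖z‖ (norm_nonneg z)

lemma EntireCoeff.succ_mul {a : ℕ → ℂ} (ha : EntireCoeff a) :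
    EntireCoeff fun m => ((m : ℂ) + 1) * a m := by
  intro r hr
  refine .of_nonneg_of_le (fun m => by positivity) (fun m => ?_) (ha (2 * r) (by positivity))
  have hm : ‖(m : ℂ) + 1‖ = (m : ℝ) + 1 := by
    exact_mod_cast Complex.norm_natCast (m + 1)
  have h2 : (m : ℝ) + 1 ≤ 2 ^ m := by exact_mod_cast m.lt_two_pow_self
  rw [norm_mul, hm, mul_pow]
  calc ((m : ℝ) + 1) * ‖a m‖ * r ^ m ≤ 2 ^ m * ‖a m‖ * r ^ m := by gcongr
    _ = ‖a m‖ * (2 ^ m * r ^ m) := by ring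

lemma EntireCoeff.Lop_tsum {a : ℕ → ℂ} (ha : EntireCoeff a) :
    Lop (fun z => ∑' m, a m * z ^ m) = fun z => ∑' m : ℕ, ((m : ℂ) + 1) * a m * z ^ m := by
  funext z
  have hmul : (fun t : ℂ => t * ∑' m, a m * t ^ m) = fun t => ∑' m, a m * t ^ (m + 1) := by
    funext t
    rw [← tsum_mul_left]
    exact tsum_congr fun m => by ring
  have hz : z ∈ Metric.ball (0 : ℂ) (‖z‖ + 1) := by simp
  rw [Lop, hmul]
  refine HasDerivAt.deriv (hasDerivAt_tsum_of_isPreconnected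
    (g := fun m t => a m * t ^ (m + 1)) (g' := fun m t => ((m : ℂ) + 1) * a m * t ^ m)
    (ha.succ_mul (‖z‖ + 1) (by positivity)) Metric.isOpen_ball
    (convex_ball (0 : ℂ) (‖z‖ + 1)).isPreconnected (fun m y _ => ?_) (fun m y hy => ?_) hz ?_
    hz)
  · refine ((hasDerivAt_pow (m + 1) y).const_mul (a m)).congr_deriv ?_
    push_cast
    ring
  · rw [norm_mul, norm_pow]
    have hy' : ‖y‖ ≤ ‖z‖ + 1 := (mem_ball_zero_iff.mp hy).le
    gcongr
  · exact ((ha.summable z).mul_left z).congr fun m => by ring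

lemma EntireCoeff.Lop_iterate_tsum {a : ℕ → ℂ} (ha : EntireCoeff a) (k : ℕ) :
    EntireCoeff (fun m => ((m : ℂ) + 1) ^ k * a m) ∧
      Lop^[k] (fun z => ∑' m, a m * z ^ m) =
        fun z => ∑' m : ℕ, ((m : ℂ) + 1) ^ k * a m * z ^ m := by
  induction k with
  | zero => simpa using ha
  | succ k ih =>
    obtain ⟨hk, hL⟩ := ih
    have hpow : (fun m : ℕ => ((m : ℂ) + 1) ^ (k + 1) * a m) =
        fun m : ℕ => ((m : ℂ) + 1) * (((m : ℂ) + 1) ^ k * a m) := by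
      funext m
      ring
    refine ⟨hpow ▸ hk.succ_mul, ?_⟩
    rw [Function.iterate_succ_apply', hL, hk.Lop_tsum]
    funext z
    exact tsum_congr fun m => by ring

/-- The coefficients of the partition function `Z_k` as a power series in `x`. -/
noncomputable def partitionCoeff (k : ℕ) (hbar : ℂ) (m : ℕ) : ℂ :=
  (m.factorial : ℂ) ^ k * Complex.exp ((m : ℂ) * ((m : ℂ) - 1) / 2 * hbar) * (hbar ^ k) ^ m

lemma partitionCoeff_zero (k : ℕ) (hbar : ℂ) : partitionCoeff k hbar 0 = 1 := by
  simp [partitionCoeff]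

lemma partitionCoeff_succ (k : ℕ) (hbar : ℂ) (m : ℕ) :
    partitionCoeff k hbar (m + 1) =
      hbar ^ k * ((m : ℂ) + 1) ^ k * Complex.exp hbar ^ m * partitionCoeff k hbar m := by
  have hexp : Complex.exp (((m + 1 : ℕ) : ℂ) * (((m + 1 : ℕ) : ℂ) - 1) / 2 * hbar) =
      Complex.exp hbar ^ m * Complex.exp ((m : ℂ) * ((m : ℂ) - 1) / 2 * hbar) := by
    rw [← Complex.exp_nat_mul, ← Complex.exp_add]
    congr 1
    push_cast
    ring
  rw [partitionCoeff, partitionCoeff, hexp, Nat.factorial_succ, Nat.cast_mul, mul_pow]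
  push_cast
  ring

lemma entireCoeff_partitionCoeff (k : ℕ) {hbar : ℂ} (hh : hbar.re < 0) :
    EntireCoeff (partitionCoeff k hbar) := by
  intro r hr
  set q : ℝ := ‖Complex.exp hbar‖ with hq
  have hq0 : 0 < q := norm_pos_iff.mpr (Complex.exp_ne_zero _)
  have hq1 : q < 1 := by rw [hq, Complex.norm_exp]; simpa using hh
  have hlim : Tendsto (fun m : ℕ => ‖hbar‖ ^ k * r / q * (((m + 1 : ℕ) : ℝ) ^ k * q ^ (m + 1)))
      atTop (𝓝 0) := by
    simpa using ((tendsto_pow_const_mul_const_pow_of_abs_lt_one k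
      (by rwa [abs_of_pos hq0])).comp (tendsto_add_atTop_nat 1)).const_mul (‖hbar‖ ^ k * r / q)
  refine summable_of_ratio_norm_eventually_le (r := 1 / 2) (by norm_num) ?_
  filter_upwards [hlim.eventually_le_const (by norm_num : (0 : ℝ) < 1 / 2)] with m hm
  have hcast : ‖(m : ℂ) + 1‖ = ((m + 1 : ℕ) : ℝ) := by
    exact_mod_cast Complex.norm_natCast (m + 1)
  rw [Real.norm_of_nonneg (by positivity), Real.norm_of_nonneg (by positivity)]
  calc ‖partitionCoeff k hbar (m + 1)‖ * r ^ (m + 1)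
      = ‖hbar‖ ^ k * r / q * (((m + 1 : ℕ) : ℝ) ^ k * q ^ (m + 1)) *
          (‖partitionCoeff k hbar m‖ * r ^ m) := by
        rw [partitionCoeff_succ]
        simp only [norm_mul, norm_pow, hcast, ← hq]
        field_simp
        ring
    _ ≤ 1 / 2 * (‖partitionCoeff k hbar m‖ * r ^ m) := by gcongr

/-- The quantum curve equation: with
`Z_k(x, hbar) = Σ_m (m!)^k · exp(½ m (m-1) hbar) · (hbar^k x)^m`, for every `x ∈ ℂ`,
`hbar · x · d/dx [ Z_k(x, hbar) − hbar^k · x · (L^k Z_k(·, hbar))(e^hbar · x) ] = 0`,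
i.e. `Z_k(·, hbar)` is annihilated by
`P = hbar x (d/dx) ∘ (1 − hbar^k x e^{hbar x d/dx} ((d/dx)·x)^k)`. -/
theorem quantum_curve_equation (k : ℕ) (hk : 1 ≤ k) (hbar : ℂ)
    (hh : hbar.re < 0) (x : ℂ) :
    hbar * x *
      deriv (fun y : ℂ =>
        (∑' m : ℕ,
          (m.factorial : ℂ) ^ k * Complex.exp ((m : ℂ) * ((m : ℂ) - 1) / 2 * hbar) *
            (hbar ^ k * y) ^ m)
        - hbar ^ k * y *
          (Lop^[k] (fun z : ℂ => ∑' m : ℕ,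
            (m.factorial : ℂ) ^ k * Complex.exp ((m : ℂ) * ((m : ℂ) - 1) / 2 * hbar) *
              (hbar ^ k * z) ^ m)) (Complex.exp hbar * y)) x = 0 := by
  have hZ : (fun z : ℂ => ∑' m : ℕ,
      (m.factorial : ℂ) ^ k * Complex.exp ((m : ℂ) * ((m : ℂ) - 1) / 2 * hbar) *
        (hbar ^ k * z) ^ m) = fun z => ∑' m, partitionCoeff k hbar m * z ^ m := by
    funext z
    exact tsum_congr fun m => by rw [partitionCoeff, mul_pow, mul_assoc _ _ (z ^ m)]
  have ha := entireCoeff_partitionCoeff k hh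
  rw [hZ, (ha.Lop_iterate_tsum k).2]
  have hconst : ∀ y : ℂ, (∑' m : ℕ,
      (m.factorial : ℂ) ^ k * Complex.exp ((m : ℂ) * ((m : ℂ) - 1) / 2 * hbar) *
        (hbar ^ k * y) ^ m) - hbar ^ k * y *
      ∑' m : ℕ, ((m : ℂ) + 1) ^ k * partitionCoeff k hbar m * (Complex.exp hbar * y) ^ m =
        1 := by
    intro y
    rw [congrFun hZ y, (ha.summable y).tsum_eq_zero_add, ← tsum_mul_left, partitionCoeff_zero,
      pow_zero, mul_one, add_sub_assoc, add_eq_left, sub_eq_zero]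
    exact tsum_congr fun m => by rw [partitionCoeff_succ]; ring
  simp only [hconst, deriv_const, mul_zero]
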